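/- (Midpoint inequality for q-calculus) Let 0<q<1, a<b be real numbers, f:[a,b]→ℝ a q-integrable function over [a,b], and set m₀ = ⌊log_q(1/2)⌋. Then |f(a + q^{m₀}(b−a)) − (1/(b−a))·∫_a^b f(t) d_q^a t| ≤ (b−a)·((1 + 2q^{2m₀+1})/(1+q) − q^{m₀})·‖D_q^a f‖_∞^{(a,b]}. -/

import Mathlib

open Set

/-- Shifted q-derivative of `f` (with base point `a`). -/
noncomputable def qDeriv (q a : ℝ) (f : ℝ → ℝ) (x : ℝ) : ℝ :=
  (f x - f (a + q * (x - a))) / ((1 - q) * (x - a))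

/-- Shifted q-integral of `f` over `[a,b]`. -/
noncomputable def qIntegral (q a b : ℝ) (f : ℝ → ℝ) : ℝ :=
  (1 - q) * (b - a) * ∑' k : ℕ, q ^ k * f (a + q ^ k * (b - a))

/-- `f` is q-integrable over `[a,b]`. -/
def qIntegrable (q a b : ℝ) (f : ℝ → ℝ) : Prop :=
  Summable fun k : ℕ => q ^ k * f (a + q ^ k * (b - a))

/-- A bound on the q-derivative controls increments of `f` along the q-lattice. -/
lemma abs_sub_qLattice_le_of_le {q a b M : ℝ} {f : ℝ → ℝ} (hq : 0 < q) (hq1 : q < 1)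
    (hab : a < b) (hM : ∀ t ∈ Set.Ioc a b, |qDeriv q a f t| ≤ M) {j k : ℕ} (hjk : j ≤ k) :
    |f (a + q ^ j * (b - a)) - f (a + q ^ k * (b - a))| ≤ (b - a) * M * (q ^ j - q ^ k) := by
  have hba : 0 < b - a := sub_pos.2 hab
  induction k, hjk using Nat.le_induction with
  | base => simp
  | succ k _ ih =>
    have hk : 0 < q ^ k := pow_pos hq k
    have hk1 : q ^ k ≤ 1 := pow_le_one₀ hq.le hq1.le
    have h := hM (a + q ^ k * (b - a)) ⟨by nlinarith [mul_pos hk hba], by nlinarith⟩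
    have hd : 0 < (1 - q) * (q ^ k * (b - a)) := mul_pos (sub_pos.2 hq1) (mul_pos hk hba)
    rw [qDeriv, add_sub_cancel_left, abs_div, abs_of_pos hd, div_le_iff₀ hd,
      ← mul_assoc q, ← pow_succ'] at h
    have htri := abs_sub_le (f (a + q ^ j * (b - a))) (f (a + q ^ k * (b - a)))
      (f (a + q ^ (k + 1) * (b - a)))
    calc _ ≤ (b - a) * M * (q ^ j - q ^ k) + M * ((1 - q) * (q ^ k * (b - a))) := by linarith
      _ = _ := by ring

lemma abs_sub_qLattice_le {q a b M : ℝ} {f : ℝ → ℝ} (hq : 0 < q) (hq1 : q < 1)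
    (hab : a < b) (hM : ∀ t ∈ Set.Ioc a b, |qDeriv q a f t| ≤ M) (j k : ℕ) :
    |f (a + q ^ j * (b - a)) - f (a + q ^ k * (b - a))| ≤ (b - a) * M * |q ^ j - q ^ k| := by
  rcases le_total j k with h | h
  · rw [abs_of_nonneg (sub_nonneg.2 (pow_le_pow_of_le_one hq.le hq1.le h))]
    exact abs_sub_qLattice_le_of_le hq hq1 hab hM h
  · rw [abs_sub_comm, abs_sub_comm (q ^ j),
      abs_of_nonneg (sub_nonneg.2 (pow_le_pow_of_le_one hq.le hq1.le h))]
    exact abs_sub_qLattice_le_of_le hq hq1 hab hM h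

lemma sum_range_pow_mul_pow_sub {q : ℝ} (hq : 0 < q) (hq1 : q < 1) (c : ℝ) (n : ℕ) :
    ∑ k ∈ Finset.range n, q ^ k * (q ^ k - c) =
      (1 - q ^ (2 * n)) / ((1 - q) * (1 + q)) - c * (1 - q ^ n) / (1 - q) := by
  have h1 : 1 - q ≠ 0 := (sub_pos.2 hq1).ne'
  have h2 : 1 + q ≠ 0 := by positivity
  induction n with
  | zero => simp
  | succ n ih =>
    rw [Finset.sum_range_succ, ih]
    field_simp
    ring

lemma hasSum_pow_mul_abs_pow_sub {q : ℝ} (hq : 0 < q) (hq1 : q < 1) (m : ℕ) :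
    HasSum (fun k : ℕ => (1 - q) * (q ^ k * |q ^ m - q ^ k|))
      ((1 + 2 * q ^ (2 * m + 1)) / (1 + q) - q ^ m) := by
  have h1 : 1 - q ≠ 0 := (sub_pos.2 hq1).ne'
  have h2 : 1 + q ≠ 0 := by positivity
  have hgeom := (hasSum_geometric_of_lt_one hq.le hq1).mul_right (q ^ m)
  have hsq := hasSum_geometric_of_lt_one (sq_nonneg q) (by nlinarith : q ^ 2 < 1)
  have hfin : HasSum (fun k : ℕ => if k ∈ Finset.range m then q ^ k * (q ^ k - q ^ m) else 0)
      (∑ k ∈ Finset.range m, q ^ k * (q ^ k - q ^ m)) := by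
    rw [← Finset.sum_congr rfl fun k hk => if_pos hk]
    exact hasSum_sum_of_ne_finset_zero fun k hk => if_neg hk
  have h := ((hgeom.sub hsq).add (hfin.mul_left 2)).mul_left (1 - q)
  rw [sum_range_pow_mul_pow_sub hq hq1] at h
  have hval : (1 + 2 * q ^ (2 * m + 1)) / (1 + q) - q ^ m = (1 - q) *
      ((1 - q)⁻¹ * q ^ m - (1 - q ^ 2)⁻¹ + 2 * ((1 - q ^ (2 * m)) / ((1 - q) * (1 + q)) -
        q ^ m * (1 - q ^ m) / (1 - q))) := by
    rw [show 1 - q ^ 2 = (1 - q) * (1 + q) by ring]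
    field_simp
    ring
  rw [hval]
  refine (funext fun k => ?_ : (fun k : ℕ => (1 - q) * (q ^ k * |q ^ m - q ^ k|)) = _) ▸ h
  by_cases hk : k < m
  · rw [if_pos (Finset.mem_range.2 hk), abs_of_nonpos
      (sub_nonpos.2 (pow_le_pow_of_le_one hq.le hq1.le hk.le))]
    ring
  · rw [if_neg (by simpa using hk), abs_of_nonneg
      (sub_nonneg.2 (pow_le_pow_of_le_one hq.le hq1.le (not_lt.1 hk)))]
    ring

/-- midpoint inequality for q-calculus. -/
theorem stmt_11 (q a b : ℝ) (hq : 0 < q) (hq1 : q < 1) (hab : a < b)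
    (f : ℝ → ℝ) (hf : qIntegrable q a b f)
    (m₀ : ℕ) (hm₀ : (m₀ : ℝ) = ⌊Real.log (1 / 2) / Real.log q⌋)
    (M : ℝ) (hM : ∀ t ∈ Set.Ioc a b, |qDeriv q a f t| ≤ M) :
    |f (a + q ^ m₀ * (b - a)) - (1 / (b - a)) * qIntegral q a b f| ≤
      (b - a) * ((1 + 2 * q ^ (2 * m₀ + 1)) / (1 + q) - q ^ m₀) * M := by
  have h1 : 1 - q ≠ 0 := (sub_pos.2 hq1).ne'
  have hba : b - a ≠ 0 := (sub_pos.2 hab).ne'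
  have hbound := (hasSum_pow_mul_abs_pow_sub hq hq1 m₀).mul_left ((b - a) * M)
  have hgeom := (hasSum_geometric_of_lt_one hq.le hq1).mul_right (f (a + q ^ m₀ * (b - a)))
  have hdiff := (hgeom.sub (Summable.hasSum hf)).mul_left (1 - q)
  have hle := tsum_of_norm_bounded hbound fun k => by
    show ‖(1 - q) * (q ^ k * f (a + q ^ m₀ * (b - a)) - q ^ k * f (a + q ^ k * (b - a)))‖ ≤ _
    rw [← mul_sub, norm_mul, norm_mul, Real.norm_of_nonneg (sub_pos.2 hq1).le,
      Real.norm_of_nonneg (pow_pos hq k).le, Real.norm_eq_abs]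
    calc _ ≤ (1 - q) * (q ^ k * ((b - a) * M * |q ^ m₀ - q ^ k|)) := by
          have := (sub_pos.2 hq1).le
          gcongr
          exact abs_sub_qLattice_le hq hq1 hab hM m₀ k
      _ = _ := by ring
  rw [hdiff.tsum_eq, Real.norm_eq_abs] at hle
  convert hle using 1
  · rw [qIntegral]
    congr 1
    field_simp
  · ring
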